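/- For every g ∈ F and every Borel set E ⊆ ∂F one has μ({g⁻¹·ω : ω ∈ E}) = ∫_E (2m−1)^{−b_ω(g)} dμ(ω). In particular, the uniform measure μ is quasi-invariant under the action of F on ∂F, and the Radon–Nikodym derivative of the translated measure g_*μ with respect to μ is given μ-a.e. by d(g_*μ)/dμ(ω) = (2m−1)^{−b_ω(g)}. -/

import Mathlib

open MeasureTheory Filter Topology
open scoped ENNReal symmDiff

noncomputable section

/-- A letter of the alphabet `A ∪ A⁻¹` for the free group on `Fin m`. -/
abbrev Letter (m : ℕ) := Fin m × Bool

/-- The inverse letter. -/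
def linv {m : ℕ} (x : Letter m) : Letter m := (x.1, !x.2)

/-- A sequence of letters is reduced if no letter is followed by its inverse. -/
def IsRedSeq {m : ℕ} (ω : ℕ → Letter m) : Prop := ∀ n, ω (n + 1) ≠ linv (ω n)

/-- The boundary `∂F`: infinite reduced words. -/
abbrev Boundary (m : ℕ) := {ω : ℕ → Letter m // IsRedSeq ω}

/-- Word length of an element of the free group. -/
def wlen {m : ℕ} (g : FreeGroup (Fin m)) : ℕ := g.toWord.length

/-- The truncation `[ω]ₙ`: the group element given by the first `n` letters of `ω`. -/
def trunc {m : ℕ} (ω : Boundary m) (n : ℕ) : FreeGroup (Fin m) :=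
  FreeGroup.mk (List.ofFn fun i : Fin n => ω.1 i)

/-- Cylinder set `C_g`. -/
def cylinder {m : ℕ} (g : FreeGroup (Fin m)) : Set (Boundary m) :=
  {ω | trunc ω (wlen g) = g}

/-- The Gromov product `(g|ω)`: length of the longest common initial segment of the
reduced word of `g` and `ω`. -/
def gromov {m : ℕ} (g : FreeGroup (Fin m)) (ω : Boundary m) : ℕ :=
  sSup {k | ∀ i < k, g.toWord[i]? = some (ω.1 i)}

/-- The Busemann function `b_ω(g) = |g| - 2 (g|ω)`. -/
def busemann {m : ℕ} (g : FreeGroup (Fin m)) (ω : Boundary m) : ℤ :=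
  (wlen g : ℤ) - 2 * (gromov g ω : ℤ)

/-- The number of letters cancelled in the free reduction of the concatenation
of a finite word `w` with an infinite reduced word `ω`. -/
def cancelLen {m : ℕ} (w : List (Letter m)) (ω : ℕ → Letter m) : ℕ :=
  sSup {k | k ≤ w.length ∧ ∀ i < k, w[w.length - 1 - i]? = some (linv (ω i))}

/-- The sequence of letters of the free reduction of (reduced word of `g`) ++ `ω`. -/
def actSeq {m : ℕ} (g : FreeGroup (Fin m)) (ω : Boundary m) (n : ℕ) : Letter m :=
  if h : n < g.toWord.length - cancelLen g.toWord ω.1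
  then g.toWord[n]'(by omega)
  else ω.1 (n - (g.toWord.length - cancelLen g.toWord ω.1) + cancelLen g.toWord ω.1)

theorem linv_linv {m : ℕ} (x : Letter m) : linv (linv x) = x := by
  simp [linv]

theorem toWord_chain {m : ℕ} (g : FreeGroup (Fin m)) {j : ℕ} (hj : j + 1 < g.toWord.length) :
    g.toWord[j + 1]'hj ≠ linv (g.toWord[j]'(by omega)) := by
  intro h
  have hsplit : g.toWord = g.toWord.take j ++
      (g.toWord[j]'(by omega)) :: (g.toWord[j+1]'hj) :: g.toWord.drop (j + 2) := by
    conv_lhs => rw [← List.take_append_drop j g.toWord]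
    congr 1
    rw [List.drop_eq_getElem_cons (by omega)]
    congr 1
    rw [List.drop_eq_getElem_cons (by omega)]
  rw [h] at hsplit
  have hred : FreeGroup.reduce g.toWord = g.toWord := FreeGroup.reduce_toWord g
  exact FreeGroup.reduce.not (by rw [hred, hsplit]; rfl)

theorem cancelLen_spec {m : ℕ} (w : List (Letter m)) (ω : ℕ → Letter m) :
    cancelLen w ω ≤ w.length ∧
      ∀ i < cancelLen w ω, w[w.length - 1 - i]? = some (linv (ω i)) := by
  have : cancelLen w ω ∈
      {k | k ≤ w.length ∧ ∀ i < k, w[w.length - 1 - i]? = some (linv (ω i))} := by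
    apply Nat.sSup_mem ⟨0, by simp⟩ ⟨w.length, fun x hx => hx.1⟩
  exact this

theorem cancelLen_max {m : ℕ} (w : List (Letter m)) (ω : ℕ → Letter m)
    (hlt : cancelLen w ω < w.length) :
    w[w.length - 1 - cancelLen w ω]? ≠ some (linv (ω (cancelLen w ω))) := by
  intro hcon
  have hmem : cancelLen w ω + 1 ∈
      {k | k ≤ w.length ∧ ∀ i < k, w[w.length - 1 - i]? = some (linv (ω i))} := by
    refine ⟨hlt, fun i hi => ?_⟩
    rcases Nat.lt_succ_iff_lt_or_eq.mp hi with h | h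
    · exact (cancelLen_spec w ω).2 i h
    · subst h; exact hcon
  have := le_csSup ⟨w.length, fun x hx => hx.1⟩ hmem
  simp only [cancelLen] at this ⊢
  omega

theorem isRedSeq_actSeq {m : ℕ} (g : FreeGroup (Fin m)) (ω : Boundary m) :
    IsRedSeq (actSeq g ω) := by
  intro n
  obtain ⟨hkle, hcan⟩ := cancelLen_spec g.toWord ω.1
  by_cases h1 : n + 1 < g.toWord.length - cancelLen g.toWord ω.1
  · have h0 : n < g.toWord.length - cancelLen g.toWord ω.1 := by omega
    rw [show actSeq g ω (n + 1) = g.toWord[n + 1]'(by omega) from dif_pos h1,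
        show actSeq g ω n = g.toWord[n]'(by omega) from dif_pos h0]
    exact toWord_chain g (by omega)
  · by_cases h0 : n < g.toWord.length - cancelLen g.toWord ω.1
    · have hklt : cancelLen g.toWord ω.1 < g.toWord.length := by omega
      have hidx : n = g.toWord.length - 1 - cancelLen g.toWord ω.1 := by omega
      have e0 : actSeq g ω n = g.toWord[n]'(by omega) := dif_pos h0
      have e1 : actSeq g ω (n + 1) =
          ω.1 (n + 1 - (g.toWord.length - cancelLen g.toWord ω.1) +
            cancelLen g.toWord ω.1) := dif_neg h1
      have harg : n + 1 - (g.toWord.length - cancelLen g.toWord ω.1) +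
          cancelLen g.toWord ω.1 = cancelLen g.toWord ω.1 := by omega
      rw [harg] at e1
      rw [e0, e1]
      intro hcon
      apply cancelLen_max g.toWord ω.1 hklt
      subst hidx
      rw [List.getElem?_eq_getElem (by omega), hcon, linv_linv]
    · have e0 : actSeq g ω n =
          ω.1 (n - (g.toWord.length - cancelLen g.toWord ω.1) +
            cancelLen g.toWord ω.1) := dif_neg h0
      have e1 : actSeq g ω (n + 1) =
          ω.1 (n + 1 - (g.toWord.length - cancelLen g.toWord ω.1) +
            cancelLen g.toWord ω.1) := dif_neg (by omega)
      have harg : n + 1 - (g.toWord.length - cancelLen g.toWord ω.1) +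
          cancelLen g.toWord ω.1 =
          (n - (g.toWord.length - cancelLen g.toWord ω.1) + cancelLen g.toWord ω.1) + 1 := by
        omega
      rw [e0, e1, harg]
      exact ω.2 _

/-- The boundary action of `F` on `∂F`: `g · ω` is the free reduction of the
concatenation of the reduced word of `g` with `ω`. -/
def bact {m : ℕ} (g : FreeGroup (Fin m)) (ω : Boundary m) : Boundary m :=
  ⟨actSeq g ω, isRedSeq_actSeq g ω⟩


theorem gromov_eq_iff {m : ℕ} {g : FreeGroup (Fin m)} {ω : Boundary m} {k : ℕ} :
    gromov g ω = k ↔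
      (∀ i < k, g.toWord[i]? = some (ω.1 i)) ∧ g.toWord[k]? ≠ some (ω.1 k) := by
  set S : Set ℕ := {k | ∀ i < k, g.toWord[i]? = some (ω.1 i)} with hS
  have hbdd : BddAbove S := by
    refine ⟨g.toWord.length, fun k hk => ?_⟩
    by_contra! hlt
    simpa using hk _ hlt
  have hmem : gromov g ω ∈ S := Nat.sSup_mem ⟨0, by simp [hS]⟩ hbdd
  have hmax : ∀ j ∈ S, j ≤ gromov g ω := fun j hj => le_csSup hbdd hj
  constructor
  · rintro rfl
    refine ⟨hmem, fun h => ?_⟩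
    have : gromov g ω + 1 ∈ S := fun i hi => by
      rcases Nat.lt_succ_iff_lt_or_eq.mp hi with h' | rfl
      · exact hmem i h'
      · exact h
    have := hmax _ this
    omega
  · rintro ⟨h₁, h₂⟩
    refine le_antisymm ?_ (hmax k h₁)
    by_contra! hlt
    exact h₂ (hmem k hlt)

theorem gromov_le_wlen {m : ℕ} (g : FreeGroup (Fin m)) (ω : Boundary m) :
    gromov g ω ≤ wlen g := by
  by_contra! hlt
  simpa [wlen] using (gromov_eq_iff.mp (rfl : gromov g ω = _)).1 _ hlt

theorem wlen_inv {m : ℕ} (g : FreeGroup (Fin m)) : wlen g⁻¹ = wlen g := by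
  simp [wlen, FreeGroup.toWord_inv]

theorem toWord_inv_getElem? {m : ℕ} (g : FreeGroup (Fin m)) {i : ℕ} (hi : i < wlen g) :
    g⁻¹.toWord[i]? = (g.toWord[wlen g - 1 - i]?).map linv := by
  rw [FreeGroup.toWord_inv, FreeGroup.invRev,
    List.getElem?_reverse (by rwa [List.length_map]), List.length_map,
    List.getElem?_map]
  rfl

/-- The letters cancelled by `g⁻¹` in `ω` are those common to `g` and `ω`. -/
theorem cancelLen_inv {m : ℕ} (g : FreeGroup (Fin m)) (ω : Boundary m) :
    cancelLen g⁻¹.toWord ω.1 = gromov g ω := by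
  have hlen : g⁻¹.toWord.length = wlen g := wlen_inv g
  have key : ∀ i < wlen g, (g⁻¹.toWord[g⁻¹.toWord.length - 1 - i]? = some (linv (ω.1 i)) ↔
      g.toWord[i]? = some (ω.1 i)) := fun i hi => by
    rw [hlen, toWord_inv_getElem? g (by omega),
      show wlen g - 1 - (wlen g - 1 - i) = i by omega, Option.map_eq_some_iff]
    constructor
    · rintro ⟨a, ha, hl⟩
      rw [ha, ← linv_linv a, hl, linv_linv]
    · exact fun h => ⟨_, h, rfl⟩
  obtain ⟨hle, hspec⟩ := cancelLen_spec g⁻¹.toWord ω.1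
  refine (gromov_eq_iff.mpr ⟨fun i hi => (key i (by omega)).mp (hspec i hi), fun h => ?_⟩).symm
  have hlt : cancelLen g⁻¹.toWord ω.1 < wlen g := by
    by_contra! hge
    rw [List.getElem?_eq_none hge] at h
    cases h
  exact cancelLen_max g⁻¹.toWord ω.1 (by omega) ((key _ hlt).mpr h)

theorem bact_inv_apply_of_lt {m : ℕ} (g : FreeGroup (Fin m)) (ω : Boundary m) {i : ℕ}
    (hi : i < wlen g - gromov g ω) : g⁻¹.toWord[i]? = some ((bact g⁻¹ ω).1 i) := by
  have h : i < g⁻¹.toWord.length - cancelLen g⁻¹.toWord ω.1 := by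
    rwa [cancelLen_inv, show g⁻¹.toWord.length = wlen g from wlen_inv g]
  have e : (bact g⁻¹ ω).1 i = g⁻¹.toWord[i]'(by omega) := dif_pos h
  rw [e, List.getElem?_eq_getElem]

theorem bact_inv_apply_add {m : ℕ} (g : FreeGroup (Fin m)) (ω : Boundary m) (i : ℕ) :
    (bact g⁻¹ ω).1 (wlen g - gromov g ω + i) = ω.1 (gromov g ω + i) := by
  have hlen : g⁻¹.toWord.length = wlen g := wlen_inv g
  have e : (bact g⁻¹ ω).1 (wlen g - gromov g ω + i) = ω.1 (wlen g - gromov g ω + i -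
      (g⁻¹.toWord.length - cancelLen g⁻¹.toWord ω.1) + cancelLen g⁻¹.toWord ω.1) :=
    dif_neg (by rw [cancelLen_inv, hlen]; omega)
  rw [e, cancelLen_inv, hlen]
  exact congrArg ω.1 (by omega)

theorem gromov_inv_bact_inv {m : ℕ} (g : FreeGroup (Fin m)) (ω : Boundary m) :
    gromov g⁻¹ (bact g⁻¹ ω) = wlen g - gromov g ω := by
  refine gromov_eq_iff.mpr ⟨fun i hi => bact_inv_apply_of_lt g ω hi, fun h => ?_⟩
  have hle := gromov_le_wlen g ω
  have hc := bact_inv_apply_add g ω 0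
  simp only [add_zero] at hc
  have hlt : wlen g - gromov g ω < wlen g := by
    by_contra! hge
    rw [List.getElem?_eq_none ((wlen_inv g).trans_le hge)] at h
    cases h
  rw [hc, toWord_inv_getElem? g hlt, (gromov_eq_iff.mp (rfl : gromov g ω = _)).1 _ (by omega),
    Option.map_some, Option.some_inj] at h
  have hr := ω.2 (wlen g - 1 - (wlen g - gromov g ω))
  rw [h] at hr
  exact hr (congrArg ω.1 (by omega))

theorem bact_bact_inv {m : ℕ} (g : FreeGroup (Fin m)) (ω : Boundary m) :
    bact g (bact g⁻¹ ω) = ω := by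
  have hle := gromov_le_wlen g ω
  have hlt := fun i => @bact_inv_apply_of_lt m g⁻¹ (bact g⁻¹ ω) i
  have hadd := bact_inv_apply_add g⁻¹ (bact g⁻¹ ω)
  rw [gromov_inv_bact_inv, wlen_inv, inv_inv,
    show wlen g - (wlen g - gromov g ω) = gromov g ω by omega] at hadd
  rw [gromov_inv_bact_inv, wlen_inv, inv_inv,
    show wlen g - (wlen g - gromov g ω) = gromov g ω by omega] at hlt
  refine Subtype.ext (funext fun i => ?_)
  rcases lt_or_ge i (gromov g ω) with hi | hi
  · have h := hlt i hi
    rw [(gromov_eq_iff.mp (rfl : gromov g ω = _)).1 i hi, Option.some_inj] at h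
    exact h.symm
  · obtain ⟨j, rfl⟩ := Nat.exists_eq_add_of_le hi
    rw [hadd, bact_inv_apply_add]

theorem bact_inv_bact {m : ℕ} (g : FreeGroup (Fin m)) (ω : Boundary m) :
    bact g⁻¹ (bact g ω) = ω := by
  simpa using bact_bact_inv g⁻¹ ω

theorem image_bact_inv {m : ℕ} (g : FreeGroup (Fin m)) (E : Set (Boundary m)) :
    bact g⁻¹ '' E = bact g ⁻¹' E :=
  congrFun (Set.image_eq_preimage_of_inverse (bact_bact_inv g) (bact_inv_bact g)) E

/-- The infinite reduced words that share their first `n` letters with `u`. -/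
def boundaryCylinder {m : ℕ} (n : ℕ) (u : Boundary m) : Set (Boundary m) :=
  {ω | ∀ i < n, ω.1 i = u.1 i}

theorem mem_boundaryCylinder_self {m : ℕ} (n : ℕ) (u : Boundary m) : u ∈ boundaryCylinder n u :=
  fun _ _ => rfl

theorem boundaryCylinder_eq_of_mem {m n : ℕ} {u ω : Boundary m} (h : ω ∈ boundaryCylinder n u) :
    boundaryCylinder n ω = boundaryCylinder n u := by
  ext η
  exact forall₂_congr fun i hi => by rw [h i hi]

theorem boundaryCylinder_anti {m : ℕ} (u : Boundary m) : Antitone fun n => boundaryCylinder n u :=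
  fun _ _ h _ hω i hi => hω i (hi.trans_le h)

theorem gromov_eq_of_mem_boundaryCylinder {m n : ℕ} {g : FreeGroup (Fin m)} {u ω : Boundary m}
    (hn : gromov g u < n) (h : ω ∈ boundaryCylinder n u) : gromov g ω = gromov g u := by
  obtain ⟨h₁, h₂⟩ := gromov_eq_iff.mp (rfl : gromov g u = _)
  refine gromov_eq_iff.mpr ⟨fun i hi => ?_, ?_⟩
  · rw [h i (hi.trans hn), h₁ i hi]
  · rwa [h _ hn]

theorem bact_inv_mem_boundaryCylinder {m n : ℕ} {g : FreeGroup (Fin m)} {u ω : Boundary m}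
    (hn : gromov g u < n) (h : ω ∈ boundaryCylinder n u) :
    bact g⁻¹ ω ∈ boundaryCylinder (n + wlen g - 2 * gromov g u) (bact g⁻¹ u) := by
  have hg := gromov_eq_of_mem_boundaryCylinder hn h
  have hle := gromov_le_wlen g u
  intro i hi
  rcases lt_or_ge i (wlen g - gromov g u) with hlt | hge
  · have h₁ := bact_inv_apply_of_lt g ω (hg.symm ▸ hlt)
    rw [bact_inv_apply_of_lt g u hlt, Option.some_inj] at h₁
    exact h₁.symm
  · obtain ⟨j, rfl⟩ := Nat.exists_eq_add_of_le hge
    have h₁ := bact_inv_apply_add g ω j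
    rw [hg] at h₁
    rw [h₁, bact_inv_apply_add]
    exact h _ (by omega)

theorem preimage_bact_boundaryCylinder {m n : ℕ} {g : FreeGroup (Fin m)} {u : Boundary m}
    (hn : gromov g u < n) :
    bact g ⁻¹' boundaryCylinder n u = boundaryCylinder (n + wlen g - 2 * gromov g u) (bact g⁻¹ u) := by
  have hle := gromov_le_wlen g u
  ext ω
  constructor
  · intro h
    simpa [bact_inv_bact] using bact_inv_mem_boundaryCylinder hn h
  · intro h
    have h₁ := bact_inv_mem_boundaryCylinder (g := g⁻¹) (by rw [gromov_inv_bact_inv]; omega) h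
    rw [inv_inv, bact_bact_inv, gromov_inv_bact_inv, wlen_inv] at h₁
    exact boundaryCylinder_anti u (by omega) h₁

theorem finite_range_boundaryCylinder {m : ℕ} (n : ℕ) :
    (Set.range (boundaryCylinder (m := m) n)).Finite := by
  refine (Set.finite_range fun v : Fin n → Letter m =>
    {ω : Boundary m | ∀ i : Fin n, ω.1 i = v i}).subset ?_
  rintro _ ⟨u, rfl⟩
  refine ⟨fun i => u.1 i, ?_⟩
  ext ω
  exact ⟨fun h i hi => h ⟨i, hi⟩, fun h i => h i i.2⟩

theorem sUnion_image_boundaryCylinder {m n : ℕ} {s : Set (Boundary m)}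
    (hs : ∀ u ∈ s, boundaryCylinder n u ⊆ s) : ⋃₀ (boundaryCylinder n '' s) = s := by
  refine Set.Subset.antisymm (Set.sUnion_subset ?_) fun u hu =>
    ⟨_, ⟨u, hu, rfl⟩, mem_boundaryCylinder_self n u⟩
  rintro _ ⟨u, hu, rfl⟩
  exact hs u hu

theorem measurableSet_of_boundaryCylinder_subset {m n : ℕ} [M : MeasurableSpace (Boundary m)]
    (hM : ∀ u : Boundary m, MeasurableSet (boundaryCylinder n u)) {s : Set (Boundary m)}
    (hs : ∀ u ∈ s, boundaryCylinder n u ⊆ s) : MeasurableSet s := by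
  rw [← sUnion_image_boundaryCylinder hs]
  refine MeasurableSet.sUnion
    ((finite_range_boundaryCylinder n).subset (Set.image_subset_range _ _)).countable ?_
  rintro _ ⟨u, -, rfl⟩
  exact hM u

theorem measurableSet_boundaryCylinder {m : ℕ} (n : ℕ) (u : Boundary m) :
    MeasurableSet (boundaryCylinder n u) := by
  have : boundaryCylinder n u = ⋂ i, ⋂ (_ : i < n), {ω : Boundary m | ω.1 i = u.1 i} := by
    ext ω
    simp [boundaryCylinder]
  rw [this]
  exact MeasurableSet.iInter fun i => MeasurableSet.iInter fun _ =>
    measurableSet_eq_fun ((measurable_pi_apply i).comp measurable_subtype_coe) measurable_const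

/-- The sets of words with a prescribed initial segment of length at least `N`. -/
def longCylinders (m N : ℕ) : Set (Set (Boundary m)) :=
  {s | ∃ n ≥ N, ∃ u, s = boundaryCylinder n u}

theorem isPiSystem_longCylinders (m N : ℕ) : IsPiSystem (longCylinders m N) := by
  rintro _ ⟨n, hn, u, rfl⟩ _ ⟨k, hk, v, rfl⟩ ⟨ω, hu, hv⟩
  rw [← boundaryCylinder_eq_of_mem hu, ← boundaryCylinder_eq_of_mem hv]
  refine ⟨max n k, by omega, ω, Set.Subset.antisymm (fun η h i hi => ?_) fun η h =>
    ⟨boundaryCylinder_anti ω (le_max_left n k) h, boundaryCylinder_anti ω (le_max_right n k) h⟩⟩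
  rcases lt_max_iff.mp hi with hi | hi
  · exact h.1 i hi
  · exact h.2 i hi

theorem generateFrom_longCylinders (m N : ℕ) :
    (inferInstance : MeasurableSpace (Boundary m)) =
      MeasurableSpace.generateFrom (longCylinders m N) := by
  apply le_antisymm
  · suffices h : @Measurable _ _ (MeasurableSpace.generateFrom (longCylinders m N)) _
        (Subtype.val : Boundary m → ℕ → Letter m) from h.comap_le
    let M := MeasurableSpace.generateFrom (longCylinders m N)
    refine measurable_pi_iff.mpr fun i => measurable_to_countable' fun a => ?_
    refine measurableSet_of_boundaryCylinder_subset (M := M) (n := max N (i + 1)) (fun u =>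
      MeasurableSpace.measurableSet_generateFrom ⟨_, le_max_left _ _, u, rfl⟩) ?_
    intro u hu ω hω
    exact (hω i (by omega)).trans hu
  · refine MeasurableSpace.generateFrom_le ?_
    rintro _ ⟨n, -, u, rfl⟩
    exact measurableSet_boundaryCylinder n u

theorem measurable_bact {m : ℕ} (g : FreeGroup (Fin m)) : Measurable (bact g) := by
  have h : @Measurable _ _ _ (MeasurableSpace.generateFrom (longCylinders m (wlen g + 1)))
      (bact g) := by
    refine measurable_generateFrom ?_
    rintro _ ⟨n, hn, u, rfl⟩
    rw [preimage_bact_boundaryCylinder (by have := gromov_le_wlen g u; omega)]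
    exact measurableSet_boundaryCylinder _ _
  rwa [← generateFrom_longCylinders] at h

theorem measurable_comp_busemann {m : ℕ} {β : Type*} [MeasurableSpace β] (φ : ℤ → β)
    (g : FreeGroup (Fin m)) : Measurable fun ω : Boundary m => φ (busemann g ω) := by
  have hgromov : Measurable (gromov (m := m) g) := by
    refine measurable_to_countable' fun k =>
      measurableSet_of_boundaryCylinder_subset (measurableSet_boundaryCylinder (wlen g + 1)) ?_
    intro u hu ω hω
    exact (gromov_eq_of_mem_boundaryCylinder (Nat.lt_succ_of_le (gromov_le_wlen g u)) hω).trans hu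
  exact (measurable_from_top (f := fun k : ℕ => φ (wlen g - 2 * k))).comp hgromov

theorem toWord_trunc {m : ℕ} (ω : Boundary m) (n : ℕ) :
    (trunc ω n).toWord = List.ofFn fun i : Fin n => ω.1 i := by
  rw [trunc, FreeGroup.toWord_mk]
  refine FreeGroup.IsReduced.reduce_eq ?_
  refine List.isChain_iff_getElem.mpr fun i hi h₁ => ?_
  simp only [List.getElem_ofFn] at h₁ ⊢
  by_contra h₂
  refine ω.2 i (Prod.ext h₁.symm ?_)
  simp only [linv]
  revert h₂
  cases (ω.1 i).2 <;> cases (ω.1 (i + 1)).2 <;> simp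

theorem wlen_trunc {m : ℕ} (ω : Boundary m) (n : ℕ) : wlen (trunc ω n) = n := by
  rw [wlen, toWord_trunc, List.length_ofFn]

theorem cylinder_trunc {m : ℕ} (u : Boundary m) (n : ℕ) :
    cylinder (trunc u n) = boundaryCylinder n u := by
  ext ω
  rw [_root_.cylinder, Set.mem_ofPred_eq, wlen_trunc, ← FreeGroup.toWord_inj, toWord_trunc,
    toWord_trunc, List.ofFn_inj, funext_iff]
  exact ⟨fun h i hi => h ⟨i, hi⟩, fun h i => h i i.2⟩

theorem measure_boundaryCylinder {m : ℕ} {μ : Measure (Boundary m)}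
    (hμ : ∀ g : FreeGroup (Fin m), g ≠ 1 →
      μ (cylinder g) = ((2 * m * (2 * m - 1) ^ (wlen g - 1) : ℕ) : ℝ≥0∞)⁻¹)
    {n : ℕ} (hn : n ≠ 0) (u : Boundary m) :
    μ (boundaryCylinder n u) = ((2 * m * (2 * m - 1) ^ (n - 1) : ℕ) : ℝ≥0∞)⁻¹ := by
  have h := hμ (trunc u n) fun h => hn (by rw [← wlen_trunc u n, h]; simp [wlen])
  rwa [cylinder_trunc, wlen_trunc] at h

theorem map_bact_eq_withDensity {m : ℕ} (hm : 2 ≤ m) {μ : Measure (Boundary m)}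
    [IsProbabilityMeasure μ]
    (hμ : ∀ g : FreeGroup (Fin m), g ≠ 1 →
      μ (cylinder g) = ((2 * m * (2 * m - 1) ^ (wlen g - 1) : ℕ) : ℝ≥0∞)⁻¹)
    (g : FreeGroup (Fin m)) :
    Measure.map (bact g) μ =
      μ.withDensity fun ω => ((2 * m - 1 : ℕ) : ℝ≥0∞) ^ (-(busemann g ω)) := by
  have := Measure.isProbabilityMeasure_map (μ := μ) (measurable_bact g).aemeasurable
  refine Measure.ext_of_generateFrom_of_cover_subset
    (generateFrom_longCylinders m (wlen g + 1)) (isPiSystem_longCylinders m (wlen g + 1))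
    (T := boundaryCylinder (wlen g + 1) '' Set.univ) ?_
    ((finite_range_boundaryCylinder _).subset (Set.image_subset_range _ _)).countable
    (sUnion_image_boundaryCylinder fun _ _ => Set.subset_univ _) (fun _ _ => measure_ne_top _ _) ?_
  · rintro _ ⟨u, -, rfl⟩
    exact ⟨_, le_rfl, u, rfl⟩
  rintro _ ⟨n, hn, u, rfl⟩
  have hle := gromov_le_wlen g u
  have hlt : gromov g u < n := by omega
  have hdens : Set.EqOn (fun ω => ((2 * m - 1 : ℕ) : ℝ≥0∞) ^ (-(busemann g ω)))
      (fun _ => ((2 * m - 1 : ℕ) : ℝ≥0∞) ^ (-(busemann g u))) (boundaryCylinder n u) :=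
    fun ω hω => by simp only [busemann, gromov_eq_of_mem_boundaryCylinder hlt hω]
  rw [Measure.map_apply (measurable_bact g) (measurableSet_boundaryCylinder n u),
    preimage_bact_boundaryCylinder hlt, withDensity_apply _ (measurableSet_boundaryCylinder n u),
    setLIntegral_congr_fun (measurableSet_boundaryCylinder n u) hdens, setLIntegral_const,
    measure_boundaryCylinder hμ (by omega), measure_boundaryCylinder hμ (by omega)]
  have hq₀ : ((2 * m - 1 : ℕ) : ℝ≥0∞) ≠ 0 := Nat.cast_ne_zero.mpr (by omega)
  have hq : ((2 * m - 1 : ℕ) : ℝ≥0∞) ≠ ∞ := ENNReal.natCast_ne_top _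
  have hsplit : ∀ k : ℕ, ((2 * m * (2 * m - 1) ^ k : ℕ) : ℝ≥0∞)⁻¹ =
      ((2 * m : ℕ) : ℝ≥0∞)⁻¹ * ((2 * m - 1 : ℕ) : ℝ≥0∞) ^ (-(k : ℤ)) := fun k => by
    rw [Nat.cast_mul, Nat.cast_pow, ENNReal.mul_inv (Or.inr (ENNReal.pow_ne_top hq))
      (Or.inl (ENNReal.natCast_ne_top _)), ENNReal.zpow_neg, zpow_natCast]
  rw [hsplit, hsplit, mul_left_comm, ← ENNReal.zpow_add hq₀ hq, busemann]
  congr 2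
  omega

/-- **Quasi-invariance of the uniform measure and its Radon–Nikodym cocycle.**
For every `g ∈ F` and Borel `E ⊆ ∂F`, `μ(g⁻¹E) = ∫_E (2m-1)^{-b_ω(g)} dμ(ω)`; in
particular `μ` is quasi-invariant and `d(g_*μ)/dμ(ω) = (2m-1)^{-b_ω(g)}` a.e. -/
theorem uniform_measure_quasi_invariant_radon_nikodym (m : ℕ) (hm : 2 ≤ m)
    (μ : Measure (Boundary m)) [IsProbabilityMeasure μ]
    (hμ : ∀ g : FreeGroup (Fin m), g ≠ 1 →
      μ (cylinder g) = ((2 * m * (2 * m - 1) ^ (wlen g - 1) : ℕ) : ℝ≥0∞)⁻¹) :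
    ∀ g : FreeGroup (Fin m),
      (∀ E : Set (Boundary m), MeasurableSet E →
        μ (bact g⁻¹ '' E) = ∫⁻ ω in E, ((2 * m - 1 : ℕ) : ℝ≥0∞) ^ (-(busemann g ω)) ∂μ) ∧
      Measure.map (bact g) μ ≪ μ ∧ μ ≪ Measure.map (bact g) μ ∧
      (Measure.map (bact g) μ).rnDeriv μ =ᵐ[μ]
        (fun ω => ((2 * m - 1 : ℕ) : ℝ≥0∞) ^ (-(busemann g ω))) := by
  intro g
  have hmap := map_bact_eq_withDensity hm hμ g
  have hmeas := measurable_comp_busemann (fun b => ((2 * m - 1 : ℕ) : ℝ≥0∞) ^ (-b)) g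
  have hpos : ∀ ω : Boundary m, ((2 * m - 1 : ℕ) : ℝ≥0∞) ^ (-(busemann g ω)) ≠ 0 := fun ω =>
    (ENNReal.zpow_pos (Nat.cast_ne_zero.mpr (by omega)) (ENNReal.natCast_ne_top _) _).ne'
  refine ⟨fun E hE => ?_, ?_, ?_, ?_⟩
  · rw [image_bact_inv, ← Measure.map_apply (measurable_bact g) hE, hmap, withDensity_apply _ hE]
  · rw [hmap]
    exact withDensity_absolutelyContinuous μ _
  · rw [hmap]
    exact withDensity_absolutelyContinuous' hmeas.aemeasurable (ae_of_all μ hpos)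
  · rw [hmap]
    exact Measure.rnDeriv_withDensity μ hmeas
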